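/- Let G be a finite simple graph, let (C_1, …, C_{i(G)}) be a local chordalization partition of a hole cover C of G realizing the non-chordality index i(G), and let G* be the last graph of the corresponding chordalization chain. Then for every induced subgraph H of G, if H* denotes the subgraph of G* induced by V(H), then ω(H*) ≤ ω(H) + i(G). In particular, ω(G*) ≤ ω(G) + i(G). Moreover, if G is non-chordal and has no K_n minor, then ω(G*) ≤ n − 2 + i(G). -/

import Mathlib

open SimpleGraph

variable {V : Type*}

/-- A *hole* of `G`: an induced cycle of length at least 4, given as a closed walk. -/
def IsHole (G : SimpleGraph V) {a : V} (w : G.Walk a a) : Prop :=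
  w.IsCycle ∧ 4 ≤ w.length ∧
    ∀ x y : V, x ∈ w.support → y ∈ w.support → G.Adj x y → s(x, y) ∈ w.edges

/-- A graph is *chordal* if it has no hole. -/
def IsChordal (G : SimpleGraph V) : Prop :=
  ∀ (a : V) (w : G.Walk a a), ¬ IsHole G w

/-- Two edge lists share two consecutive edges. -/
def ShareTwoConsecutiveEdges (l₁ l₂ : List (Sym2 V)) : Prop :=
  ∃ x y z : V, x ≠ z ∧ s(x, y) ∈ l₁ ∧ s(y, z) ∈ l₁ ∧ s(x, y) ∈ l₂ ∧ s(y, z) ∈ l₂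

/-- A vertex `u` satisfies the *NC property* in `G`: no hole through `u` and
no hole avoiding `u` share two consecutive edges. -/
def VertexNC (G : SimpleGraph V) (u : V) : Prop :=
  ∀ (a b : V) (w₁ : G.Walk a a) (w₂ : G.Walk b b),
    IsHole G w₁ → IsHole G w₂ → u ∈ w₁.support → u ∉ w₂.support →
      ¬ ShareTwoConsecutiveEdges w₁.edges w₂.edges

/-- A *hole cover* of `G`: a nonempty vertex set meeting every hole of `G`. -/
def IsHoleCover (G : SimpleGraph V) (C : Set V) : Prop :=
  C.Nonempty ∧ ∀ (a : V) (w : G.Walk a a), IsHole G w → ∃ u ∈ C, u ∈ w.support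

/-- A vertex set `C` satisfies the *NC property* in `G`: every vertex of `C`
satisfies the NC property and every hole of `G` contains at most one vertex of `C`. -/
def SetNC (G : SimpleGraph V) (C : Set V) : Prop :=
  (∀ u ∈ C, VertexNC G u) ∧
    ∀ (a : V) (w : G.Walk a a), IsHole G w →
      ∀ u ∈ C, ∀ v ∈ C, u ∈ w.support → v ∈ w.support → u = v

/-- A graph satisfies the *NC property* if it has a hole cover satisfying the NC property. -/
def HasNCProperty (G : SimpleGraph V) : Prop :=
  ∃ C : Set V, IsHoleCover G C ∧ SetNC G C

/-- A DP-cover of `G` with lists of size `k`, realized on the vertex set `V × Fin k`: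
the fibers `{v} × Fin k` are cliques, cross edges exist only over edges of `G`,
and the edges between two fibers form a matching. -/
def IsDPCover (G : SimpleGraph V) (k : ℕ) (H : SimpleGraph (V × Fin k)) : Prop :=
  (∀ (v : V) (i j : Fin k), i ≠ j → H.Adj (v, i) (v, j)) ∧
  (∀ (u v : V) (i j : Fin k), u ≠ v → H.Adj (u, i) (v, j) → G.Adj u v) ∧
  (∀ (u v : V) (i j j' : Fin k), u ≠ v → H.Adj (u, i) (v, j) → H.Adj (u, i) (v, j') → j = j')

/-- `G` is DP-`k`-colorable: every DP-cover with lists of size `k` admits an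
independent transversal. -/
def DPColorable (G : SimpleGraph V) (k : ℕ) : Prop :=
  ∀ H : SimpleGraph (V × Fin k), IsDPCover G k H →
    ∃ f : V → Fin k, ∀ u v : V, ¬ H.Adj (u, f u) (v, f v)

/-- The DP-chromatic number: the least `k` such that `G` is DP-`k`-colorable. -/
noncomputable def dpChromaticNumber (G : SimpleGraph V) : ℕ :=
  sInf {k | DPColorable G k}

/-- `M` is a minor of `G`, via the branch-set characterization. -/
def HasMinor {W : Type*} (G : SimpleGraph V) (M : SimpleGraph W) : Prop :=
  ∃ B : W → Set V,
    (∀ i, (B i).Nonempty) ∧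
    (∀ i, (G.induce (B i)).Connected) ∧
    (Pairwise fun i j => Disjoint (B i) (B j)) ∧
    ∀ i j, M.Adj i j → ∃ a ∈ B i, ∃ b ∈ B j, G.Adj a b

/-- Locally chordalize by `u` all holes of `G` containing `u`: add all edges
joining `u` to the vertices of such holes (new edges go to the vertices
nonadjacent to `u`). -/
def localChordalize (G : SimpleGraph V) (u : V) : SimpleGraph V :=
  G ⊔ SimpleGraph.fromRel fun x y =>
    x = u ∧ ∃ (a : V) (w : G.Walk a a), IsHole G w ∧ u ∈ w.support ∧ y ∈ w.support

/-- Recursive local chordalizations along a list of vertices. -/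
def chordalizeList (G : SimpleGraph V) : List V → SimpleGraph V
  | [] => G
  | u :: l => chordalizeList (localChordalize G u) l

/-- Delete a vertex set (keeping the ambient vertex type: the removed vertices
become isolated). -/
def removeVerts (G : SimpleGraph V) (A : Set V) : SimpleGraph V where
  Adj x y := G.Adj x y ∧ x ∉ A ∧ y ∉ A
  symm := ⟨by intro x y h; exact ⟨h.1.symm, h.2.2, h.2.1⟩⟩
  loopless := ⟨by intro x h; exact G.loopless.irrefl x h.1⟩

/-- The chordalization chain corresponding to an ordered partition
`parts 0, …, parts (k-1)` (playing the role of `C₁, …, C_k`) of a hole cover: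
`(lcChain G parts i).1 = Gᵢ` and `(lcChain G parts i).2 = Gᵢ*`. -/
def lcChain (G : SimpleGraph V) {k : ℕ} (parts : Fin k → List V) :
    ℕ → SimpleGraph V × SimpleGraph V
  | 0 =>
      (removeVerts G {v | ∃ i, v ∈ parts i}, removeVerts G {v | ∃ i, v ∈ parts i})
  | i + 1 =>
      let Gi := (lcChain G parts i).2 ⊔
        removeVerts G {v | ∃ j : Fin k, i + 1 ≤ (j : ℕ) ∧ v ∈ parts j}
      (Gi, if h : i < k then chordalizeList Gi (parts ⟨i, h⟩) else Gi)

/-- `(parts 0, …, parts (k-1))` is a *local chordalization partition* of the hole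
cover `C` of `G`. -/
def IsLCPartition (G : SimpleGraph V) (C : Set V) {k : ℕ} (parts : Fin k → List V) : Prop :=
  (∀ i, (parts i).Nodup) ∧
  (∀ i, parts i ≠ []) ∧
  (Pairwise fun i j : Fin k => ∀ v, v ∈ parts i → v ∉ parts j) ∧
  {v | ∃ i, v ∈ parts i} = C ∧
  ∀ i : Fin k,
    IsHoleCover (lcChain G parts ((i : ℕ) + 1)).1 {v | v ∈ parts i} ∧
    SetNC (lcChain G parts ((i : ℕ) + 1)).1 {v | v ∈ parts i} ∧
    IsChordal (lcChain G parts ((i : ℕ) + 1)).2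

/-- The *non-chordality index* of `G`. -/
noncomputable def ncIndex (G : SimpleGraph V) : ℕ := by
  classical exact
    if IsChordal G then 0
    else sInf {k | ∃ (C : Set V) (parts : Fin k → List V),
      IsHoleCover G C ∧ IsLCPartition G C parts}

/-- `G` is `k`-list-colorable. -/
def ListColorable (G : SimpleGraph V) (k : ℕ) : Prop :=
  ∀ L : V → Finset ℕ, (∀ v, k ≤ (L v).card) →
    ∃ f : V → ℕ, (∀ v, f v ∈ L v) ∧ ∀ u v : V, G.Adj u v → f u ≠ f v

/-- The list chromatic number of `G`. -/
noncomputable def listChromaticNumber (G : SimpleGraph V) : ℕ :=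
  sInf {k | ListColorable G k}

/-! ### Connectivity inside a vertex set -/

/-- One step inside the set `T`. -/
def StepIn (G : SimpleGraph V) (T : Set V) (x y : V) : Prop :=
  G.Adj x y ∧ x ∈ T ∧ y ∈ T

/-- The set `T` is connected (or empty) in `G`. -/
def Conn (G : SimpleGraph V) (T : Set V) : Prop :=
  ∀ x ∈ T, ∀ y ∈ T, Relation.ReflTransGen (StepIn G T) x y

/-- The sets `A` and `B` intersect or are joined by an edge. -/
def Touch (G : SimpleGraph V) (A B : Set V) : Prop :=
  ∃ x ∈ A, ∃ y ∈ B, x = y ∨ G.Adj x y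

theorem Touch.symm {G : SimpleGraph V} {A B : Set V} (h : Touch G A B) : Touch G B A := by
  obtain ⟨x, hx, y, hy, h⟩ := h
  exact ⟨y, hy, x, hx, h.imp Eq.symm fun h => h.symm⟩

theorem stepIn_mono {G : SimpleGraph V} {S T : Set V} (h : S ⊆ T) {x y : V}
    (hxy : Relation.ReflTransGen (StepIn G S) x y) : Relation.ReflTransGen (StepIn G T) x y :=
  Relation.ReflTransGen.mono (r := StepIn G S) (p := StepIn G T)
    (fun _ _ h' => ⟨h'.1, h h'.2.1, h h'.2.2⟩) _ _ hxy

theorem Conn.union {G : SimpleGraph V} {S T : Set V} (hS : Conn G S) (hT : Conn G T)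
    (h : Touch G S T) : Conn G (S ∪ T) := by
  obtain ⟨a, ha, b, hb, hab⟩ := h
  have key : Relation.ReflTransGen (StepIn G (S ∪ T)) a b := by
    rcases hab with rfl | hab
    · exact .refl
    · exact .single ⟨hab, Or.inl ha, Or.inr hb⟩
  have key' : Relation.ReflTransGen (StepIn G (S ∪ T)) b a := by
    rcases hab with rfl | hab
    · exact .refl
    · exact .single ⟨hab.symm, Or.inr hb, Or.inl ha⟩
  have l : S ⊆ S ∪ T := Set.subset_union_left
  have r : T ⊆ S ∪ T := Set.subset_union_right
  rintro x (hx | hx) y (hy | hy)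
  · exact stepIn_mono l (hS x hx y hy)
  · exact (stepIn_mono l (hS x hx a ha)).trans (key.trans (stepIn_mono r (hT b hb y hy)))
  · exact (stepIn_mono r (hT x hx b hb)).trans (key'.trans (stepIn_mono l (hS a ha y hy)))
  · exact stepIn_mono r (hT x hx y hy)

theorem conn_singleton (G : SimpleGraph V) (a : V) : Conn G {a} := by
  rintro x rfl y rfl
  exact .refl

theorem conn_image (G : SimpleGraph V) (f : ℕ → V) (a b : ℕ)
    (h : ∀ i, a ≤ i → i < b → G.Adj (f i) (f (i + 1))) : Conn G (f '' Set.Icc a b) := by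
  have up : ∀ d i, a ≤ i → i + d ≤ b →
      Relation.ReflTransGen (StepIn G (f '' Set.Icc a b)) (f i) (f (i + d)) ∧
      Relation.ReflTransGen (StepIn G (f '' Set.Icc a b)) (f (i + d)) (f i) := by
    intro d
    induction d with
    | zero => intro i _ _; exact ⟨.refl, .refl⟩
    | succ d ih =>
      intro i hi hd
      obtain ⟨h1, h2⟩ := ih i hi (by omega)
      have hadj := h (i + d) (by omega) (by omega)
      have m1 : f (i + d) ∈ f '' Set.Icc a b := ⟨_, ⟨by omega, by omega⟩, rfl⟩
      have m2 : f (i + d + 1) ∈ f '' Set.Icc a b := ⟨_, ⟨by omega, by omega⟩, rfl⟩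
      exact ⟨h1.tail ⟨hadj, m1, m2⟩, h2.head ⟨hadj.symm, m2, m1⟩⟩
  rintro _ ⟨i, hi, rfl⟩ _ ⟨j, hj, rfl⟩
  rcases le_total i j with hij | hij
  · obtain ⟨d, rfl⟩ := Nat.exists_eq_add_of_le hij
    exact (up d i hi.1 hj.2).1
  · obtain ⟨d, rfl⟩ := Nat.exists_eq_add_of_le hij
    exact (up d j hj.1 hi.2).2

/-- A connected set inside the union of two sets that do not touch lies in one of them. -/
theorem Conn.not_split {G : SimpleGraph V} {T A B : Set V} (hT : Conn G T)
    (hsub : T ⊆ A ∪ B) (hAB : ¬ Touch G A B) {s t : V} (hs : s ∈ T) (ht : t ∈ T)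
    (hsA : s ∈ A) (htB : t ∈ B) : False := by
  have key : t ∈ A := by
    have := hT s hs t ht
    induction this with
    | refl => exact hsA
    | tail _ hbc ih =>
      rename_i b c hh
      have hb : b ∈ A := by
        rcases hsub hbc.2.1 with hb | hb
        · exact hb
        · exact ih hbc.2.1 hb
      exact absurd ⟨b, hb, c, htB, Or.inr hbc.1⟩ hAB
  exact hAB ⟨t, key, t, htB, Or.inl rfl⟩

theorem Conn.exists_walk {G : SimpleGraph V} {T : Set V} (hT : Conn G T) {s t : V}
    (hs : s ∈ T) (ht : t ∈ T) : ∃ p : G.Walk s t, ∀ x ∈ p.support, x ∈ T := by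
  have := hT s hs t ht
  induction this with
  | refl => exact ⟨.nil, by simpa using hs⟩
  | tail _ hbc ih =>
    obtain ⟨p, hp⟩ := ih hbc.2.1
    refine ⟨p.concat hbc.1, ?_⟩
    intro x hx
    rw [Walk.support_concat] at hx
    simp only [List.mem_append, List.mem_singleton] at hx
    rcases hx with hx | rfl
    · exact hp x hx
    · exact ht

/-- A connected nonempty set induces a connected graph. -/
theorem Conn.connected {G : SimpleGraph V} {T : Set V} (hT : Conn G T) (hne : T.Nonempty) :
    (G.induce T).Connected := by
  obtain ⟨s, hs⟩ := hne
  have : Nonempty T := ⟨⟨s, hs⟩⟩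
  refine ⟨?_⟩
  rintro ⟨x, hx⟩ ⟨y, hy⟩
  have := hT x hx y hy
  induction this with
  | refl => exact Reachable.refl _
  | tail _ hbc ih =>
    refine (ih hbc.2.1).trans (Adj.reachable ?_)
    simpa using hbc.1

/-- An induced path inside a connected set. -/
theorem Conn.exists_induced_path {G : SimpleGraph V} {T : Set V} (hT : Conn G T) {s t : V}
    (hs : s ∈ T) (ht : t ∈ T) : ∃ p : G.Walk s t, p.IsPath ∧ (∀ x ∈ p.support, x ∈ T) ∧
      ∀ i j, i < j → j ≤ p.length → G.Adj (p.getVert i) (p.getVert j) → j = i + 1 := by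
  classical
  have hex : ∃ n, ∃ p : G.Walk s t, p.length = n ∧ ∀ x ∈ p.support, x ∈ T := by
    obtain ⟨p, hp⟩ := hT.exists_walk hs ht
    exact ⟨_, p, rfl, hp⟩
  obtain ⟨p, hpn, hp⟩ := Nat.find_spec hex
  have hmin : ∀ q : G.Walk s t, (∀ x ∈ q.support, x ∈ T) → p.length ≤ q.length := by
    intro q hq
    rw [hpn]
    exact Nat.find_min' hex ⟨q, rfl, hq⟩
  refine ⟨p.bypass, p.bypass_isPath, fun x hx => hp x (p.support_bypass_subset_support hx), ?_⟩
  intro i j hij hj hadj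
  set q := p.bypass with hq
  have hql : q.length ≤ p.length := p.length_bypass_le_length
  let r : G.Walk s t := (q.take i).append (Walk.cons hadj (q.drop j))
  have hr : ∀ x ∈ r.support, x ∈ q.support := by
    intro x hx
    simp only [r, Walk.mem_support_append_iff, Walk.support_cons, List.mem_cons] at hx
    rcases hx with hx | rfl | hx
    · obtain ⟨n, rfl, hn⟩ := Walk.mem_support_iff_exists_getVert.1 hx
      rw [Walk.take_getVert]
      exact Walk.getVert_mem_support _ _
    · exact Walk.getVert_mem_support _ _
    · obtain ⟨n, rfl, hn⟩ := Walk.mem_support_iff_exists_getVert.1 hx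
      rw [Walk.drop_getVert]
      exact Walk.getVert_mem_support _ _
  have h1 := hmin r (fun x hx => hp x (p.support_bypass_subset_support (hr x hx)))
  have h2 : r.length = i + (q.length - j + 1) := by
    simp only [r, Walk.length_append, Walk.length_cons, Walk.take_length, Walk.drop_length]
    omega
  omega

/-! ### Holes as vertex sets -/

/-- `S` is the vertex set of a hole of `G`. -/
def HoleSet (G : SimpleGraph V) (S : Set V) : Prop :=
  ∃ (a : V) (w : G.Walk a a), IsHole G w ∧ ∀ v, v ∈ w.support ↔ v ∈ S

theorem IsHole.holeSet {G : SimpleGraph V} {a : V} {w : G.Walk a a} (h : IsHole G w) :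
    HoleSet G {v | v ∈ w.support} := ⟨a, w, h, fun _ => Iff.rfl⟩

/-- Being a hole only depends on the graph induced on the vertex set. -/
theorem HoleSet.congr {G G' : SimpleGraph V} {S : Set V} (h : HoleSet G S)
    (hG : ∀ x ∈ S, ∀ y ∈ S, G.Adj x y ↔ G'.Adj x y) : HoleSet G' S := by
  obtain ⟨a, w, ⟨hc, hl, hi⟩, hw⟩ := h
  have ht : ∀ e ∈ w.edges, e ∈ G'.edgeSet := by
    intro e he
    induction e with
    | _ x y =>
      rw [mem_edgeSet]
      exact (hG x ((hw x).1 (w.fst_mem_support_of_mem_edges he)) y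
        ((hw y).1 (w.snd_mem_support_of_mem_edges he))).1 (w.adj_of_mem_edges he)
  refine ⟨a, w.transfer G' ht, ⟨hc.transfer ht, by simpa using hl, ?_⟩, ?_⟩
  · intro x y hx hy hxy
    rw [Walk.support_transfer] at hx hy
    rw [Walk.edges_transfer]
    exact hi x y hx hy ((hG x ((hw x).1 hx) y ((hw y).1 hy)).2 hxy)
  · intro v
    rw [Walk.support_transfer]
    exact hw v

/-- A cyclic parametrization of a hole starting at a prescribed vertex. -/
theorem HoleSet.exists_param {G : SimpleGraph V} {S : Set V} (h : HoleSet G S) {u : V}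
    (hu : u ∈ S) : ∃ (n : ℕ) (f : ℕ → V), 4 ≤ n ∧ f 0 = u ∧
      (∀ i j, i < n → j < n → f i = f j → i = j) ∧
      (∀ i j, i < j → j < n → (G.Adj (f i) (f j) ↔ (j = i + 1 ∨ (i = 0 ∧ j = n - 1)))) ∧
      (∀ v, v ∈ S ↔ ∃ i, i < n ∧ f i = v) := by
  classical
  obtain ⟨a, w₀, ⟨hc₀, hl₀, hi₀⟩, hw₀⟩ := h
  have hu₀ : u ∈ w₀.support := (hw₀ u).2 hu
  obtain ⟨w, hc, hl, hi, hw⟩ : ∃ w : G.Walk u u, w.IsCycle ∧ 4 ≤ w.length ∧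
      (∀ x y : V, x ∈ w.support → y ∈ w.support → G.Adj x y → s(x, y) ∈ w.edges) ∧
      ∀ v, v ∈ w.support ↔ v ∈ S := by
    refine ⟨w₀.rotate u hu₀, hc₀.rotate hu₀, by simpa using hl₀, ?_, ?_⟩
    · intro x y hx hy hxy
      rw [Walk.mem_support_rotate_iff] at hx hy
      rw [(w₀.rotate_edges u hu₀).mem_iff]
      exact hi₀ x y hx hy hxy
    · intro v
      rw [Walk.mem_support_rotate_iff]
      exact hw₀ v
  have hinj : ∀ i j, i < w.length → j < w.length → w.getVert i = w.getVert j → i = j := by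
    intro i j hi hj hij
    exact hc.getVert_injOn' (by simp; omega) (by simp; omega) hij
  refine ⟨w.length, w.getVert, hl, w.getVert_zero, hinj, ?_, ?_⟩
  · intro i j hij hj
    constructor
    · intro hadj
      have he := hi _ _ (w.getVert_mem_support i) (w.getVert_mem_support j) hadj
      rw [Walk.mk_mem_edges_iff_exists] at he
      obtain ⟨k, hk, hke⟩ := he
      by_cases hk1 : k + 1 = w.length
      · have h0 : w.getVert (k + 1) = w.getVert 0 := by
          rw [hk1, Walk.getVert_length, Walk.getVert_zero]
        rw [h0, Sym2.eq_iff] at hke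
        rcases hke with ⟨e1, e2⟩ | ⟨e1, e2⟩
        · have := hinj _ _ (by omega) (by omega) e1
          have := hinj _ _ (by omega) (by omega) e2
          omega
        · have := hinj _ _ (by omega) (by omega) e1
          have := hinj _ _ (by omega) (by omega) e2
          omega
      · rw [Sym2.eq_iff] at hke
        rcases hke with ⟨e1, e2⟩ | ⟨e1, e2⟩
        · have := hinj _ _ (by omega) (by omega) e1
          have := hinj _ _ (by omega) (by omega) e2
          omega
        · have := hinj _ _ (by omega) (by omega) e1
          have := hinj _ _ (by omega) (by omega) e2
          omega
    · rintro (rfl | ⟨rfl, rfl⟩)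
      · exact w.adj_getVert_succ (by omega)
      · have := w.adj_getVert_succ (i := w.length - 1) (by omega)
        rw [show w.length - 1 + 1 = w.length by omega, Walk.getVert_length] at this
        rw [Walk.getVert_zero]
        exact this.symm
  · intro v
    rw [← hw v, Walk.mem_support_iff_exists_getVert]
    constructor
    · rintro ⟨i, rfl, hi⟩
      by_cases h : i = w.length
      · subst h
        exact ⟨0, by omega, by simp⟩
      · exact ⟨i, by omega, rfl⟩
    · rintro ⟨i, hi, rfl⟩
      exact ⟨i, rfl, hi.le⟩

/-- Building a hole from a vertex `u` and a connected set in which `u` has exactly two,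
nonadjacent, neighbours. -/
theorem exists_hole_of_conn {G : SimpleGraph V} {T : Set V} (hT : Conn G T) {u s t : V}
    (hu : u ∉ T) (hs : s ∈ T) (ht : t ∈ T) (hus : G.Adj u s) (hut : G.Adj u t)
    (hst : s ≠ t) (hnst : ¬ G.Adj s t)
    (huniq : ∀ x ∈ T, G.Adj u x → x = s ∨ x = t) :
    ∃ T' : Set V, T' ⊆ T ∧ Conn G T' ∧ s ∈ T' ∧ t ∈ T' ∧ HoleSet G (insert u T') := by
  obtain ⟨q, hq, hqT, hch⟩ := hT.exists_induced_path hs ht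
  have hus' : u ∉ q.support := fun h => hu (hqT u h)
  have hlen : 2 ≤ q.length := by
    by_contra hlt
    have h01 : q.length = 0 ∨ q.length = 1 := by omega
    rcases h01 with h0 | h1
    · exact hst (Walk.eq_of_length_eq_zero h0)
    · exact hnst (Walk.adj_of_length_eq_one h1)
  have hedge : ∀ i j, i < j → j ≤ q.length → G.Adj (q.getVert i) (q.getVert j) →
      s(q.getVert i, q.getVert j) ∈ q.edges := by
    intro i j hij hj hadj
    obtain rfl := hch i j hij hj hadj
    rw [Walk.mk_mem_edges_iff_exists]
    exact ⟨i, by omega, rfl⟩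
  let w : G.Walk u u := Walk.cons hus (q.concat hut.symm)
  have hsup : ∀ v, v ∈ w.support ↔ v = u ∨ v ∈ q.support := by
    intro v
    simp only [w, Walk.support_cons, Walk.support_concat,
      List.mem_cons, List.mem_append, List.not_mem_nil, or_false]
    tauto
  have hedges : ∀ e, e ∈ w.edges ↔ e = s(u, s) ∨ e ∈ q.edges ∨ e = s(t, u) := by
    intro e
    simp [w, Walk.edges_concat]
  refine ⟨{v | v ∈ q.support}, hqT, ?_, q.start_mem_support, q.end_mem_support,
    u, w, ⟨?_, ?_, ?_⟩, ?_⟩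
  · have : {v | v ∈ q.support} = q.getVert '' Set.Icc 0 q.length := by
      ext v
      simp only [Set.mem_ofPred_eq, Set.mem_image, Set.mem_Icc,
        Walk.mem_support_iff_exists_getVert]
      constructor
      · rintro ⟨i, h1, h2⟩
        exact ⟨i, ⟨by omega, h2⟩, h1⟩
      · rintro ⟨i, h1, h2⟩
        exact ⟨i, h2, h1.2⟩
    rw [this]
    exact conn_image G _ _ _ (fun i _ hi => q.adj_getVert_succ hi)
  · rw [Walk.cons_isCycle_iff]
    refine ⟨hq.concat hus' hut.symm, ?_⟩
    rw [Walk.edges_concat]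
    simp only [List.concat_eq_append, List.mem_append, List.mem_singleton, not_or]
    refine ⟨fun h => hus' (q.fst_mem_support_of_mem_edges h), ?_⟩
    intro h
    rw [Sym2.eq_iff] at h
    rcases h with ⟨h1, _⟩ | ⟨_, h2⟩
    · exact hut.ne h1
    · exact hst h2
  · simp only [w, Walk.length_cons, Walk.length_concat]
    omega
  · intro x y hx hy hxy
    rw [hsup] at hx hy
    rw [hedges]
    rcases hx with rfl | hx
    · rcases hy with rfl | hy
      · exact absurd rfl hxy.ne
      · rcases huniq y (hqT y hy) hxy with rfl | rfl
        · exact Or.inl rfl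
        · exact Or.inr (Or.inr Sym2.eq_swap)
    · rcases hy with rfl | hy
      · rcases huniq x (hqT x hx) hxy.symm with rfl | rfl
        · exact Or.inl Sym2.eq_swap
        · exact Or.inr (Or.inr rfl)
      · right; left
        obtain ⟨i, rfl, hi⟩ := Walk.mem_support_iff_exists_getVert.1 hx
        obtain ⟨j, rfl, hj⟩ := Walk.mem_support_iff_exists_getVert.1 hy
        rcases lt_trichotomy i j with h | h | h
        · exact hedge i j h hj hxy
        · subst h
          exact absurd rfl hxy.ne
        · rw [Sym2.eq_swap]
          exact hedge j i h hi hxy.symm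
  · intro v
    rw [hsup]
    rfl

/-- One of the two open sides of a hole `S` between its nonadjacent vertices `u` and `a`. -/
structure Side (G : SimpleGraph V) (S : Set V) (u a : V) (A : Set V) : Prop where
  sub : A ⊆ S
  conn : Conn G A
  hu : u ∉ A
  ha : a ∉ A
  endu : ∃ r ∈ A, G.Adj u r ∧ ∀ x ∈ A, G.Adj u x → x = r
  enda : ∃ r ∈ A, G.Adj a r ∧ ∀ x ∈ A, G.Adj a x → x = r

theorem HoleSet.split {G : SimpleGraph V} {S : Set V} (h : HoleSet G S) {u a : V}
    (hu : u ∈ S) (ha : a ∈ S) (hne : u ≠ a) (hna : ¬ G.Adj u a) :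
    ∃ A B, Side G S u a A ∧ Side G S u a B ∧ ¬ Touch G A B := by
  obtain ⟨n, f, hn, rfl, hinj, hadj, hS⟩ := h.exists_param hu
  obtain ⟨m, hm, rfl⟩ := (hS a).1 ha
  have hm0 : 0 < m := by
    rcases Nat.eq_zero_or_pos m with rfl | h
    · exact absurd rfl hne
    · exact h
  have hm' := hadj 0 m hm0 hm
  have hm2 : m ≠ 1 ∧ m ≠ n - 1 := by
    constructor
    · rintro rfl
      exact hna (hm'.2 (Or.inl rfl))
    · rintro rfl
      exact hna (hm'.2 (Or.inr ⟨rfl, rfl⟩))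
  have hsucc : ∀ i, i + 1 < n → G.Adj (f i) (f (i + 1)) := fun i hi =>
    (hadj i (i + 1) (by omega) hi).2 (Or.inl rfl)
  refine ⟨f '' Set.Icc 1 (m - 1), f '' Set.Icc (m + 1) (n - 1), ?_, ?_, ?_⟩
  · refine ⟨?_, conn_image G f _ _ (fun i _ hi => hsucc i (by omega)), ?_, ?_, ?_, ?_⟩
    · rintro _ ⟨i, ⟨h1, h2⟩, rfl⟩
      exact (hS _).2 ⟨i, by omega, rfl⟩
    · rintro ⟨i, ⟨h1, h2⟩, hi⟩
      have := hinj _ _ (by omega) (by omega) hi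
      omega
    · rintro ⟨i, ⟨h1, h2⟩, hi⟩
      have := hinj _ _ (by omega) (by omega) hi
      omega
    · refine ⟨f 1, ⟨1, ⟨by omega, by omega⟩, rfl⟩, hsucc 0 (by omega), ?_⟩
      rintro _ ⟨i, ⟨h1, h2⟩, rfl⟩ hi
      have := (hadj 0 i (by omega) (by omega)).1 hi
      rw [show i = 1 by omega]
    · refine ⟨f (m - 1), ⟨m - 1, ⟨by omega, by omega⟩, rfl⟩, ?_, ?_⟩
      · exact ((hadj (m - 1) m (by omega) hm).2 (Or.inl (by omega))).symm
      rintro _ ⟨i, ⟨h1, h2⟩, rfl⟩ hi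
      have := (hadj i m (by omega) (by omega)).1 hi.symm
      rw [show i = m - 1 by omega]
  · refine ⟨?_, conn_image G f _ _ (fun i _ hi => hsucc i (by omega)), ?_, ?_, ?_, ?_⟩
    · rintro _ ⟨i, ⟨h1, h2⟩, rfl⟩
      exact (hS _).2 ⟨i, by omega, rfl⟩
    · rintro ⟨i, ⟨h1, h2⟩, hi⟩
      have := hinj _ _ (by omega) (by omega) hi
      omega
    · rintro ⟨i, ⟨h1, h2⟩, hi⟩
      have := hinj _ _ (by omega) (by omega) hi
      omega
    · refine ⟨f (n - 1), ⟨n - 1, ⟨by omega, by omega⟩, rfl⟩, ?_, ?_⟩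
      · exact (hadj 0 (n - 1) (by omega) (by omega)).2 (Or.inr ⟨rfl, rfl⟩)
      rintro _ ⟨i, ⟨h1, h2⟩, rfl⟩ hi
      have := (hadj 0 i (by omega) (by omega)).1 hi
      rw [show i = n - 1 by omega]
    · refine ⟨f (m + 1), ⟨m + 1, ⟨by omega, by omega⟩, rfl⟩, hsucc m (by omega), ?_⟩
      rintro _ ⟨i, ⟨h1, h2⟩, rfl⟩ hi
      have := (hadj m i (by omega) (by omega)).1 hi
      rw [show i = m + 1 by omega]
  · rintro ⟨_, ⟨i, ⟨h1, h2⟩, rfl⟩, _, ⟨j, ⟨h3, h4⟩, rfl⟩, hij⟩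
    rcases hij with hij | hij
    · have := hinj _ _ (by omega) (by omega) hij
      omega
    · have := (hadj i j (by omega) (by omega)).1 hij
      omega

/-! ### The NC property in terms of vertex sets of holes -/

/-- Set version of `VertexNC`. -/
def VNC (G : SimpleGraph V) (u : V) : Prop :=
  ∀ S₁ S₂ : Set V, HoleSet G S₁ → HoleSet G S₂ → u ∈ S₁ → u ∉ S₂ →
    ∀ x y z, x ≠ z → x ∈ S₁ → y ∈ S₁ → z ∈ S₁ → x ∈ S₂ → y ∈ S₂ → z ∈ S₂ →
      G.Adj x y → G.Adj y z → False

/-- Set version of `SetNC`. -/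
def SNC (G : SimpleGraph V) (D : Set V) : Prop :=
  (∀ u ∈ D, VNC G u) ∧
    ∀ S, HoleSet G S → ∀ u ∈ D, ∀ v ∈ D, u ∈ S → v ∈ S → u = v

theorem SetNC.snc {G : SimpleGraph V} {D : Set V} (h : SetNC G D) : SNC G D := by
  refine ⟨?_, ?_⟩
  · rintro u hu S₁ S₂ ⟨a, w₁, h₁, hS₁⟩ ⟨b, w₂, h₂, hS₂⟩ hu₁ hu₂ x y z hxz x1 y1 z1 x2 y2 z2 hxy hyz
    refine h.1 u hu a b w₁ w₂ h₁ h₂ ((hS₁ u).2 hu₁) (fun h => hu₂ ((hS₂ u).1 h))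
      ⟨x, y, z, hxz, ?_, ?_, ?_, ?_⟩
    · exact h₁.2.2 _ _ ((hS₁ x).2 x1) ((hS₁ y).2 y1) hxy
    · exact h₁.2.2 _ _ ((hS₁ y).2 y1) ((hS₁ z).2 z1) hyz
    · exact h₂.2.2 _ _ ((hS₂ x).2 x2) ((hS₂ y).2 y2) hxy
    · exact h₂.2.2 _ _ ((hS₂ y).2 y2) ((hS₂ z).2 z2) hyz
  · rintro S ⟨a, w, hw, hS⟩ u hu v hv huS hvS
    exact h.2 a w hw u hu v hv ((hS u).2 huS) ((hS v).2 hvS)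

/-- A connected set `Y` anticomplete to `a` and touching both sides of a hole gives another
hole sharing two consecutive edges (those at `a`) with it. -/
theorem exists_bridge {G : SimpleGraph V} {S A B Y : Set V} {u a : V}
    (haS : a ∈ S) (hA : Side G S u a A) (hB : Side G S u a B)
    (hAB : ¬ Touch G A B) (hua : u ≠ a) (hY : Conn G Y) (huY : u ∉ Y) (haY : ¬ Touch G {a} Y)
    (hAY : Touch G A Y) (hBY : Touch G B Y) :
    ∃ Z, HoleSet G Z ∧ u ∉ Z ∧ (∃ y ∈ Y, y ∈ Z) ∧ ∃ x y z, x ≠ z ∧ x ∈ S ∧ y ∈ S ∧ z ∈ S ∧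
      x ∈ Z ∧ y ∈ Z ∧ z ∈ Z ∧ G.Adj x y ∧ G.Adj y z := by
  obtain ⟨a1, h1A, h1, h1u⟩ := hA.enda
  obtain ⟨a2, h2B, h2, h2u⟩ := hB.enda
  have hconn : Conn G ((A ∪ Y) ∪ B) := by
    refine (hA.conn.union hY hAY).union hB.conn ?_
    obtain ⟨x, hx, y, hy, hxy⟩ := hBY.symm
    exact ⟨x, Or.inr hx, y, hy, hxy⟩
  obtain ⟨T', hT', hT'c, hs, ht, hole⟩ := exists_hole_of_conn hconn (u := a) (s := a1) (t := a2)
    (by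
      rintro ((h | h) | h)
      · exact hA.ha h
      · exact haY ⟨a, rfl, a, h, Or.inl rfl⟩
      · exact hB.ha h)
    (Or.inl (Or.inl h1A)) (Or.inr h2B) h1 h2
    (fun h => hAB ⟨a1, h1A, a2, h2B, Or.inl h⟩)
    (fun h => hAB ⟨a1, h1A, a2, h2B, Or.inr h⟩)
    (by
      rintro x ((h | h) | h) hx
      · exact Or.inl (h1u x h hx)
      · exact absurd ⟨a, rfl, x, h, Or.inr hx⟩ haY
      · exact Or.inr (h2u x h hx))
  refine ⟨_, hole, ?_, ?_, a1, a, a2, ?_, hA.sub h1A, haS, hB.sub h2B, Or.inr hs, Or.inl rfl,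
    Or.inr ht, h1.symm, h2⟩
  · rintro (h | h)
    · exact hua h
    · rcases hT' h with (h | h) | h
      · exact hA.hu h
      · exact huY h
      · exact hB.hu h
  · by_contra hno
    push Not at hno
    refine hT'c.not_split (A := A) (B := B) ?_ hAB hs ht h1A h2B
    intro x hx
    rcases hT' hx with (h | h) | h
    · exact Or.inl h
    · exact absurd (Or.inr hx) (hno x h)
    · exact Or.inr h
  · intro h
    exact hAB ⟨a1, h1A, a2, h2B, Or.inl h⟩

/-- An arm from `a` to `u`: a connected set containing `a`, avoiding `u`, with exactly one
neighbour of `u`. -/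
def Arm (G : SimpleGraph V) (u a : V) (T : Set V) : Prop :=
  Conn G T ∧ a ∈ T ∧ u ∉ T ∧ ∃ s ∈ T, G.Adj u s ∧ ∀ x ∈ T, G.Adj u x → x = s

theorem Side.arm {G : SimpleGraph V} {S A : Set V} {u a : V} (hA : Side G S u a A)
    (hua : u ≠ a) (hna : ¬ G.Adj u a) : Arm G u a ({a} ∪ A) := by
  obtain ⟨a1, h1A, h1, h1u⟩ := hA.enda
  obtain ⟨r, hrA, hr, hru⟩ := hA.endu
  refine ⟨(conn_singleton G a).union hA.conn ⟨a, rfl, a1, h1A, Or.inr h1⟩, Or.inl rfl, ?_, r,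
    Or.inr hrA, hr, ?_⟩
  · rintro (h | h)
    · exact hua h
    · exact hA.hu h
  · rintro x (h | h) hx
    · obtain rfl : x = a := h
      exact absurd hx hna
    · exact hru x h hx

theorem not_touch_union {G : SimpleGraph V} {A B C : Set V} (h1 : ¬ Touch G A C)
    (h2 : ¬ Touch G B C) : ¬ Touch G (A ∪ B) C := by
  rintro ⟨x, hx | hx, y, hy, hxy⟩
  · exact h1 ⟨x, hx, y, hy, hxy⟩
  · exact h2 ⟨x, hx, y, hy, hxy⟩

/-- In a hole through the nonadjacent vertices `u` and `a` there is an arm from `a` to `u` not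
touching `Y`, unless there is a bridging hole. -/
theorem exists_arm_of_hole {G : SimpleGraph V} {S Y : Set V} {u a : V} (hS : HoleSet G S)
    (huS : u ∈ S) (haS : a ∈ S) (hua : u ≠ a) (hna : ¬ G.Adj u a) (hY : Conn G Y) (huY : u ∉ Y)
    (haY : ¬ Touch G {a} Y)
    (hno : ¬ ∃ Z, HoleSet G Z ∧ u ∉ Z ∧ (∃ y ∈ Y, y ∈ Z) ∧
      ∃ x y z, x ≠ z ∧ x ∈ S ∧ y ∈ S ∧ z ∈ S ∧
      x ∈ Z ∧ y ∈ Z ∧ z ∈ Z ∧ G.Adj x y ∧ G.Adj y z) :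
    ∃ T, Arm G u a T ∧ T ⊆ S ∧ ¬ Touch G T Y := by
  obtain ⟨A, B, hA, hB, hAB⟩ := hS.split huS haS hua hna
  by_cases hAY : Touch G A Y
  · by_cases hBY : Touch G B Y
    · exact absurd (exists_bridge haS hA hB hAB hua hY huY haY hAY hBY) hno
    · refine ⟨_, hB.arm hua hna, ?_, not_touch_union haY hBY⟩
      exact Set.union_subset (Set.singleton_subset_iff.2 haS) hB.sub
  · refine ⟨_, hA.arm hua hna, ?_, not_touch_union haY hAY⟩
    exact Set.union_subset (Set.singleton_subset_iff.2 haS) hA.sub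

/-- `y` becomes (or is) a neighbour of `u` under local chordalization. -/
def NewNbr (G : SimpleGraph V) (u y : V) : Prop :=
  G.Adj u y ∨ (u ≠ y ∧ ∃ S, HoleSet G S ∧ u ∈ S ∧ y ∈ S)

theorem localChordalize_adj {G : SimpleGraph V} {u x y : V} :
    (localChordalize G u).Adj x y ↔ G.Adj x y ∨
      (x ≠ y ∧ (x = u ∨ y = u) ∧ ∃ S, HoleSet G S ∧ x ∈ S ∧ y ∈ S) := by
  simp only [localChordalize, sup_adj, fromRel_adj]
  constructor
  · rintro (h | ⟨hne, ⟨rfl, a, w, hw, hu, hy⟩ | ⟨rfl, a, w, hw, hu, hy⟩⟩)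
    · exact Or.inl h
    · exact Or.inr ⟨hne, Or.inl rfl, _, hw.holeSet, hu, hy⟩
    · exact Or.inr ⟨hne, Or.inr rfl, _, hw.holeSet, hy, hu⟩
  · rintro (h | ⟨hne, rfl | rfl, S, ⟨a, w, hw, hS⟩, hx, hy⟩)
    · exact Or.inl h
    · exact Or.inr ⟨hne, Or.inl ⟨rfl, a, w, hw, (hS _).2 hx, (hS _).2 hy⟩⟩
    · exact Or.inr ⟨hne, Or.inr ⟨rfl, a, w, hw, (hS _).2 hy, (hS _).2 hx⟩⟩

theorem localChordalize_adj_left {G : SimpleGraph V} {u y : V} :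
    (localChordalize G u).Adj u y ↔ NewNbr G u y := by
  rw [localChordalize_adj, NewNbr]
  simp

theorem localChordalize_adj_of_ne {G : SimpleGraph V} {u x y : V} (hx : x ≠ u) (hy : y ≠ u) :
    (localChordalize G u).Adj x y ↔ G.Adj x y := by
  rw [localChordalize_adj]
  simp [hx, hy]

theorem exists_arm {G : SimpleGraph V} {u a : V} (hnc : VNC G u) (ha : NewNbr G u a) {Y : Set V}
    (hY : Conn G Y) (huY : u ∉ Y) (haY : ¬ Touch G {a} Y) :
    ∃ T, Arm G u a T ∧ (∀ x ∈ T, NewNbr G u x) ∧ ¬ Touch G T Y := by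
  by_cases hadj : G.Adj u a
  · refine ⟨{a}, ⟨conn_singleton G a, rfl, ?_, a, rfl, hadj, fun x hx _ => hx⟩, ?_, haY⟩
    · exact fun h => hadj.ne h
    · rintro x rfl
      exact Or.inl hadj
  · obtain ⟨hua, S, hS, huS, haS⟩ := ha.resolve_left hadj
    obtain ⟨T, hT, hTS, hTY⟩ := exists_arm_of_hole hS huS haS hua hadj hY huY haY (by
      rintro ⟨Z, hZ, huZ, -, x, y, z, hxz, x1, y1, z1, x2, y2, z2, hxy, hyz⟩
      exact hnc S Z hS hZ huS huZ x y z hxz x1 y1 z1 x2 y2 z2 hxy hyz)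
    refine ⟨T, hT, ?_, hTY⟩
    intro x hx
    exact Or.inr ⟨fun h => hT.2.2.1 (h ▸ hx), S, hS, huS, hTS hx⟩

/-- After locally chordalizing by a vertex `u` with the NC property, no hole contains `u`. -/
theorem not_mem_hole_localChordalize {G : SimpleGraph V} {u : V} (hnc : VNC G u) {S : Set V}
    (hS : HoleSet (localChordalize G u) S) : u ∉ S := by
  intro huS
  obtain ⟨n, f, hn, hf0, hinj, hadj, hSf⟩ := hS.exists_param huS
  have hfu : ∀ i, 0 < i → i < n → f i ≠ u := by
    intro i h0 hi h
    have := hinj i 0 hi (by omega) (h.trans hf0.symm)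
    omega
  have hadj' : ∀ i j, 0 < i → i < j → j < n → (G.Adj (f i) (f j) ↔ j = i + 1) := by
    intro i j h0 hij hj
    rw [← localChordalize_adj_of_ne (u := u) (hfu i h0 (by omega)) (hfu j (by omega) hj),
      hadj i j hij hj]
    omega
  have hnew : ∀ i, 0 < i → i < n → (NewNbr G u (f i) ↔ i = 1 ∨ i = n - 1) := by
    intro i h0 hi
    rw [← localChordalize_adj_left]
    have := hadj 0 i h0 hi
    rw [hf0] at this
    rw [this]
    omega
  have ha := (hnew 1 (by omega) (by omega)).2 (Or.inl rfl)
  have hb := (hnew (n - 1) (by omega) (by omega)).2 (Or.inr rfl)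
  have hXnew : ∀ x ∈ f '' Set.Icc 2 (n - 2), ¬ NewNbr G u x := by
    rintro _ ⟨i, ⟨h1, h2⟩, rfl⟩ h
    have := (hnew i (by omega) (by omega)).1 h
    omega
  have huX : u ∉ f '' Set.Icc 2 (n - 2) := by
    rintro ⟨i, ⟨h1, h2⟩, h⟩
    exact hfu i (by omega) (by omega) h
  have hXc : Conn G (f '' Set.Icc 2 (n - 2)) :=
    conn_image G f _ _ (fun i h1 h2 => (hadj' i (i + 1) (by omega) (by omega) (by omega)).2 rfl)
  have haX : G.Adj (f 1) (f 2) := (hadj' 1 2 (by omega) (by omega) (by omega)).2 rfl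
  have hbX : G.Adj (f (n - 2)) (f (n - 1)) :=
    (hadj' _ _ (by omega) (by omega) (by omega)).2 (by omega)
  have hab : ¬ Touch G {f (n - 1)} {f 1} := by
    rintro ⟨_, rfl, _, rfl, h | h⟩
    · have := hinj _ _ (by omega) (by omega) h
      omega
    · have := (hadj' _ _ (by omega) (by omega) (by omega)).1 h.symm
      omega
  obtain ⟨Tb, ⟨hTbc, hbTb, huTb, sb, hsbT, hsb, hsbu⟩, hTbn, hTba⟩ :=
    exists_arm hnc hb (conn_singleton G (f 1))
      (fun h => hfu 1 (by omega) (by omega) (Set.mem_singleton_iff.1 h).symm) hab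
  obtain ⟨Ta, ⟨hTac, haTa, huTa, sa, hsaT, hsa, hsau⟩, hTan, hTab⟩ :=
    exists_arm hnc ha hTbc huTb (fun h => hTba h.symm)
  have hTc : Conn G ((Ta ∪ f '' Set.Icc 2 (n - 2)) ∪ Tb) := by
    refine (hTac.union hXc ⟨f 1, haTa, f 2, ⟨2, ⟨by omega, by omega⟩, rfl⟩, Or.inr haX⟩).union
      hTbc ⟨f (n - 2), Or.inr ⟨n - 2, ⟨by omega, by omega⟩, rfl⟩, f (n - 1), hbTb, Or.inr hbX⟩
  obtain ⟨T', hT', hT'c, hs, ht, hole⟩ := exists_hole_of_conn hTc (u := u) (s := sa) (t := sb)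
    (by
      rintro ((h | h) | h)
      · exact huTa h
      · exact huX h
      · exact huTb h)
    (Or.inl (Or.inl hsaT)) (Or.inr hsbT) hsa hsb
    (fun h => hTab ⟨sa, hsaT, sb, hsbT, Or.inl h⟩)
    (fun h => hTab ⟨sa, hsaT, sb, hsbT, Or.inr h⟩)
    (by
      rintro x ((h | h) | h) hx
      · exact Or.inl (hsau x h hx)
      · exact absurd (Or.inl hx) (hXnew x h)
      · exact Or.inr (hsbu x h hx))
  refine hT'c.not_split (A := Ta) (B := Tb) ?_ hTab hs ht hsaT hsbT
  intro x hx
  rcases hT' hx with (h | h) | h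
  · exact Or.inl h
  · exact absurd (Or.inr ⟨fun e => huX (e ▸ h), _, hole, Or.inl rfl, Or.inr hx⟩) (hXnew x h)
  · exact Or.inr h

/-- Holes of the local chordalization are holes of the original graph. -/
theorem holeSet_of_localChordalize {G : SimpleGraph V} {u : V} (hnc : VNC G u) {S : Set V}
    (hS : HoleSet (localChordalize G u) S) : HoleSet G S := by
  have hu := not_mem_hole_localChordalize hnc hS
  refine hS.congr ?_
  intro x hx y hy
  exact localChordalize_adj_of_ne (fun h => hu (h ▸ hx)) (fun h => hu (h ▸ hy))

theorem SNC.localChordalize {G : SimpleGraph V} {D D' : Set V} (h : SNC G D) (hD : D' ⊆ D)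
    {u : V} (hu : u ∈ D) : SNC (localChordalize G u) D' := by
  have key := @holeSet_of_localChordalize V G u (h.1 u hu)
  refine ⟨?_, fun S hS x hx y hy => h.2 S (key hS) x (hD hx) y (hD hy)⟩
  intro v hv S₁ S₂ h₁ h₂ hv₁ hv₂ x y z hxz x1 y1 z1 x2 y2 z2 hxy hyz
  have hn := not_mem_hole_localChordalize (h.1 u hu) h₁
  have ne : ∀ t ∈ S₁, t ≠ u := fun t ht e => hn (e ▸ ht)
  exact h.1 v (hD hv) S₁ S₂ (key h₁) (key h₂) hv₁ hv₂ x y z hxz x1 y1 z1 x2 y2 z2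
    ((localChordalize_adj_of_ne (ne x x1) (ne y y1)).1 hxy)
    ((localChordalize_adj_of_ne (ne y y1) (ne z z1)).1 hyz)

/-- The edges of the recursive local chordalization. -/
theorem chordalizeList_adj {l : List V} : ∀ {G : SimpleGraph V}, SNC G {v | v ∈ l} →
    ∀ {x y : V}, (chordalizeList G l).Adj x y →
      G.Adj x y ∨ ((x ∈ l ∨ y ∈ l) ∧ ∃ S, HoleSet G S ∧ x ∈ S ∧ y ∈ S) := by
  induction l with
  | nil => intro G _ x y h; exact Or.inl h
  | cons u l ih =>
    intro G hG x y h
    have hu : u ∈ {v | v ∈ u :: l} := by simp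
    have hG' : SNC (localChordalize G u) {v | v ∈ l} :=
      hG.localChordalize (fun v hv => List.mem_cons_of_mem _ hv) hu
    rcases ih hG' h with h | ⟨hl, S, hS, hx, hy⟩
    · rw [localChordalize_adj] at h
      rcases h with h | ⟨-, hxy, hS⟩
      · exact Or.inl h
      · refine Or.inr ⟨?_, hS⟩
        rcases hxy with rfl | rfl
        · exact Or.inl (by simp)
        · exact Or.inr (by simp)
    · refine Or.inr ⟨?_, S, holeSet_of_localChordalize (hG.1 u hu) hS, hx, hy⟩
      exact hl.imp (List.mem_cons_of_mem _) (List.mem_cons_of_mem _)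

/-- Two adjacent vertices of an NC set have no common far vertex. -/
theorem no_common_far {G : SimpleGraph V} {D : Set V} (h : SNC G D) {v₁ v₂ y : V}
    (h₁ : v₁ ∈ D) (h₂ : v₂ ∈ D) (h12 : G.Adj v₁ v₂) {S₁ S₂ : Set V} (hS₁ : HoleSet G S₁)
    (hS₂ : HoleSet G S₂) (hv₁ : v₁ ∈ S₁) (hv₂ : v₂ ∈ S₂) (hy₁ : y ∈ S₁) (hy₂ : y ∈ S₂)
    (hn₁ : ¬ G.Adj v₁ y) (hn₂ : ¬ G.Adj v₂ y) : False := by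
  have aux : ∀ (v₁ v₂ : V), v₁ ∈ D → v₂ ∈ D → G.Adj v₁ v₂ → ∀ S₁ : Set V, HoleSet G S₁ →
      v₁ ∈ S₁ → y ∈ S₁ → ¬ G.Adj v₁ y → ¬ G.Adj v₂ y →
      ∃ T, Arm G v₁ y T ∧ T ⊆ S₁ ∧ ¬ Touch G T {v₂} := by
    intro v₁ v₂ h₁ h₂ h12 S₁ hS₁ hv₁ hy₁ hn₁ hn₂
    have hv₂S : v₂ ∉ S₁ := fun hv => h12.ne (h.2 S₁ hS₁ v₁ h₁ v₂ h₂ hv₁ hv)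
    refine exists_arm_of_hole hS₁ hv₁ hy₁ ?_ hn₁ (conn_singleton G v₂)
      (fun e => h12.ne e) ?_ ?_
    · rintro rfl
      exact hn₂ h12.symm
    · rintro ⟨_, rfl, _, rfl, e | e⟩
      · exact hv₂S (e ▸ hy₁)
      · exact hn₂ e.symm
    · rintro ⟨Z, hZ, -, ⟨t, rfl, htZ⟩, x, y, z, hxz, x1, y1, z1, x2, y2, z2, hxy, hyz⟩
      exact h.1 t h₂ Z S₁ hZ hS₁ htZ hv₂S x y z hxz x2 y2 z2 x1 y1 z1 hxy hyz
  obtain ⟨T₁, ⟨hT₁, hyT₁, hvT₁, s₁, hs₁T, hs₁, hs₁u⟩, -, ht₁⟩ :=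
    aux v₁ v₂ h₁ h₂ h12 S₁ hS₁ hv₁ hy₁ hn₁ hn₂
  obtain ⟨T₂, ⟨hT₂, hyT₂, hvT₂, s₂, hs₂T, hs₂, hs₂u⟩, -, ht₂⟩ :=
    aux v₂ v₁ h₂ h₁ h12.symm S₂ hS₂ hv₂ hy₂ hn₂ hn₁
  have hc : Conn G ((T₁ ∪ T₂) ∪ {v₂}) :=
    (hT₁.union hT₂ ⟨y, hyT₁, y, hyT₂, Or.inl rfl⟩).union (conn_singleton G v₂)
      ⟨s₂, Or.inr hs₂T, v₂, rfl, Or.inr hs₂.symm⟩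
  obtain ⟨T', hT', -, hs, ht, hole⟩ := exists_hole_of_conn hc (u := v₁) (s := s₁) (t := v₂)
    (by
      rintro ((h | h) | h)
      · exact hvT₁ h
      · exact ht₂ ⟨v₁, h, v₁, rfl, Or.inl rfl⟩
      · exact h12.ne h)
    (Or.inl (Or.inl hs₁T)) (Or.inr rfl) hs₁ h12
    (fun e => ht₁ ⟨s₁, hs₁T, v₂, rfl, Or.inl e⟩)
    (fun e => ht₁ ⟨s₁, hs₁T, v₂, rfl, Or.inr e⟩)
    (by
      rintro x ((h | h) | h) hx
      · exact Or.inl (hs₁u x h hx)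
      · exact absurd ⟨x, h, v₁, rfl, Or.inr hx.symm⟩ ht₂
      · exact Or.inr h)
  exact h12.ne (h.2 _ hole v₁ h₁ v₂ h₂ (Or.inl rfl) (Or.inr ht))

/-- No induced 4-cycle contains two adjacent vertices of an NC set. -/
theorem no_four_cycle {G : SimpleGraph V} {D : Set V} (h : SNC G D) {v₁ v₂ y₁ y₂ : V}
    (h₁ : v₁ ∈ D) (h₂ : v₂ ∈ D) (h12 : G.Adj v₁ v₂) (h21 : G.Adj v₂ y₁) (hy : G.Adj y₁ y₂)
    (h3 : G.Adj v₁ y₂) (hn₁ : ¬ G.Adj v₁ y₁) (hn₂ : ¬ G.Adj v₂ y₂) (hne : v₁ ≠ y₁)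
    (hne' : v₂ ≠ y₂) : False := by
  have hc : Conn G (({v₂} ∪ {y₁}) ∪ {y₂}) :=
    ((conn_singleton G v₂).union (conn_singleton G y₁) ⟨v₂, rfl, y₁, rfl, Or.inr h21⟩).union
      (conn_singleton G y₂) ⟨y₁, Or.inr rfl, y₂, rfl, Or.inr hy⟩
  obtain ⟨T', hT', -, hs, ht, hole⟩ := exists_hole_of_conn hc (u := v₁) (s := v₂) (t := y₂)
    (by
      rintro ((h | h) | h)
      · exact h12.ne h
      · exact hne h
      · exact h3.ne h)
    (Or.inl (Or.inl rfl)) (Or.inr rfl) h12 h3 hne' hn₂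
    (by
      rintro x ((h | h) | h) hx
      · exact Or.inl h
      · obtain rfl : x = y₁ := h
        exact absurd hx hn₁
      · exact Or.inr h)
  exact h12.ne (h.2 _ hole v₁ h₁ v₂ h₂ (Or.inl rfl) (Or.inr hs))

/-! ### Cliques of the chordalization -/

/-- `K` is a clique of `G`, or it is one up to a vertex `u` each of whose non-neighbours in `K`
lies in a common hole of `G` with `u`. -/
def Near (G : SimpleGraph V) (K : Set V) : Prop :=
  (∀ x ∈ K, ∀ y ∈ K, x ≠ y → G.Adj x y) ∨
    ∃ u ∈ K, (∀ x ∈ K, ∀ y ∈ K, x ≠ u → y ≠ u → x ≠ y → G.Adj x y) ∧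
      ∀ y ∈ K, y ≠ u → G.Adj u y ∨ ∃ S, HoleSet G S ∧ u ∈ S ∧ y ∈ S

theorem near_of_clique {G : SimpleGraph V} {l : List V} (h : SNC G {v | v ∈ l}) {K : Set V}
    (hK : ∀ x ∈ K, ∀ y ∈ K, x ≠ y → (chordalizeList G l).Adj x y) : Near G K := by
  by_cases hcl : ∀ x ∈ K, ∀ y ∈ K, x ≠ y → G.Adj x y
  · exact Or.inl hcl
  right
  -- every nonadjacent pair of `K` has exactly one end in `l` and lies in a hole
  have pair : ∀ x ∈ K, ∀ y ∈ K, x ≠ y → ¬ G.Adj x y →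
      (x ∈ l ∨ y ∈ l) ∧ ¬ (x ∈ l ∧ y ∈ l) ∧ ∃ S, HoleSet G S ∧ x ∈ S ∧ y ∈ S := by
    intro x hx y hy hne hn
    obtain ⟨h1, S, hS, hxS, hyS⟩ := (chordalizeList_adj h (hK x hx y hy hne)).resolve_left hn
    exact ⟨h1, fun h' => hne (h.2 S hS x h'.1 y h'.2 hxS hyS), S, hS, hxS, hyS⟩
  have orient : ∀ x ∈ K, ∀ y ∈ K, x ≠ y → ¬ G.Adj x y →
      ∃ v ∈ K, ∃ z ∈ K, v ∈ l ∧ z ∉ l ∧ (v = x ∨ v = y) ∧ v ≠ z ∧ ¬ G.Adj v z ∧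
        ∃ S, HoleSet G S ∧ v ∈ S ∧ z ∈ S := by
    intro x hx y hy hne hn
    obtain ⟨h1 | h1, h2, S, hS, hxS, hyS⟩ := pair x hx y hy hne hn
    · exact ⟨x, hx, y, hy, h1, fun h' => h2 ⟨h1, h'⟩, Or.inl rfl, hne, hn, S, hS, hxS, hyS⟩
    · exact ⟨y, hy, x, hx, h1, fun h' => h2 ⟨h', h1⟩, Or.inr rfl, hne.symm,
        fun h' => hn h'.symm, S, hS, hyS, hxS⟩
  push Not at hcl
  obtain ⟨x, hx, y, hy, hne, hn⟩ := hcl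
  obtain ⟨v₁, hv₁K, y₁, hy₁K, hv₁, hy₁, -, hne₁, hn₁, S₁, hS₁, hvS₁, hyS₁⟩ :=
    orient x hx y hy hne hn
  refine ⟨v₁, hv₁K, ?_, ?_⟩
  · intro a ha b hb hav hbv hab
    by_contra hnab
    obtain ⟨v₂, hv₂K, y₂, hy₂K, hv₂, hy₂, hv₂ab, hne₂, hn₂, S₂, hS₂, hvS₂, hyS₂⟩ :=
      orient a ha b hb hab hnab
    have h12 : v₁ ≠ v₂ := by
      rintro rfl
      rcases hv₂ab with e | e
      · exact hav e.symm
      · exact hbv e.symm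
    have a12 : G.Adj v₁ v₂ := by
      by_contra hno
      exact (pair v₁ hv₁K v₂ hv₂K h12 hno).2.1 ⟨hv₁, hv₂⟩
    have n12 : v₁ ≠ y₂ := fun e => hy₂ (e ▸ hv₁)
    have n21 : v₂ ≠ y₁ := fun e => hy₁ (e ▸ hv₂)
    have b12 : G.Adj v₁ y₂ := by
      by_contra hno
      obtain ⟨-, -, S, hS, hvS, hyS⟩ := pair v₁ hv₁K y₂ hy₂K n12 hno
      exact no_common_far h hv₁ hv₂ a12 hS hS₂ hvS hvS₂ hyS hyS₂ hno hn₂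
    have b21 : G.Adj v₂ y₁ := by
      by_contra hno
      obtain ⟨-, -, S, hS, hvS, hyS⟩ := pair v₂ hv₂K y₁ hy₁K n21 hno
      exact no_common_far h hv₁ hv₂ a12 hS₁ hS hvS₁ hvS hyS₁ hyS hn₁ hno
    have hyy : y₁ ≠ y₂ := fun e => hn₁ (e ▸ b12)
    have ayy : G.Adj y₁ y₂ := by
      by_contra hno
      rcases (pair y₁ hy₁K y₂ hy₂K hyy hno).1 with h' | h'
      · exact hy₁ h'
      · exact hy₂ h'
    exact no_four_cycle h hv₁ hv₂ a12 b21 ayy b12 hn₁ hn₂ hne₁ hne₂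
  · intro z hz hzv
    by_cases hvz : G.Adj v₁ z
    · exact Or.inl hvz
    · exact Or.inr (pair v₁ hv₁K z hz hzv.symm hvz).2.2

/-! ### The chordalization chain -/

theorem HoleSet.exists_adj {G : SimpleGraph V} {S : Set V} (h : HoleSet G S) {v : V}
    (hv : v ∈ S) : ∃ y, G.Adj v y := by
  obtain ⟨n, f, hn, rfl, -, hadj, -⟩ := h.exists_param hv
  exact ⟨f 1, (hadj 0 1 (by omega) (by omega)).2 (Or.inl rfl)⟩

theorem chordalizeList_isolated {l : List V} : ∀ {G : SimpleGraph V} {v : V},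
    (∀ y, ¬ G.Adj v y) → ∀ y, ¬ (chordalizeList G l).Adj v y := by
  induction l with
  | nil => intro G v h; exact h
  | cons u l ih =>
    intro G v h
    refine ih ?_
    intro y hy
    rw [localChordalize_adj] at hy
    rcases hy with hy | ⟨-, -, S, hS, hv, -⟩
    · exact h y hy
    · obtain ⟨z, hz⟩ := hS.exists_adj hv
      exact h z hz

theorem le_chordalizeList (l : List V) : ∀ G : SimpleGraph V, G ≤ chordalizeList G l := by
  induction l with
  | nil => intro G; exact le_rfl
  | cons u l ih => intro G; exact le_sup_left.trans (ih _)

theorem lcChain_isolated (G : SimpleGraph V) {k : ℕ} (parts : Fin k → List V) :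
    ∀ (i : ℕ) (j : Fin k), i ≤ (j : ℕ) → ∀ v ∈ parts j, ∀ y, ¬ (lcChain G parts i).2.Adj v y := by
  intro i
  induction i with
  | zero =>
    intro j _ v hv y h
    exact h.2.1 ⟨j, hv⟩
  | succ i ih =>
    intro j hj v hv
    have base : ∀ y, ¬ ((lcChain G parts i).2 ⊔
        removeVerts G {v | ∃ j : Fin k, i + 1 ≤ (j : ℕ) ∧ v ∈ parts j}).Adj v y := by
      rintro y (h | h)
      · exact ih j (by omega) v hv y h
      · exact h.2.1 ⟨j, hj, hv⟩
    simp only [lcChain]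
    split_ifs
    · exact chordalizeList_isolated base
    · exact base

theorem le_lcChain (G : SimpleGraph V) {k : ℕ} (parts : Fin k → List V) (i : ℕ) :
    removeVerts G {v | ∃ j : Fin k, i ≤ (j : ℕ) ∧ v ∈ parts j} ≤ (lcChain G parts i).2 := by
  cases i with
  | zero =>
    intro x y h
    refine ⟨h.1, ?_, ?_⟩
    · rintro ⟨j, hj⟩
      exact h.2.1 ⟨j, by omega, hj⟩
    · rintro ⟨j, hj⟩
      exact h.2.2 ⟨j, by omega, hj⟩
  | succ i =>
    simp only [lcChain]
    split_ifs
    · exact le_sup_right.trans (le_chordalizeList _ _)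
    · exact le_sup_right

theorem HoleSet.of_removeVerts {G : SimpleGraph V} {A S : Set V}
    (h : HoleSet (removeVerts G A) S) : HoleSet G S := by
  refine h.congr ?_
  have hA : ∀ x ∈ S, x ∉ A := by
    intro x hx
    obtain ⟨y, hy⟩ := h.exists_adj hx
    exact hy.2.1
  intro x hx y hy
  exact ⟨fun h' => h'.1, fun h' => ⟨h', hA x hx, hA y hy⟩⟩

theorem lcChain_clique [DecidableEq V] (G : SimpleGraph V) {C : Set V} {k : ℕ}
    (parts : Fin k → List V) (hp : IsLCPartition G C parts) :
    ∀ i : ℕ, i < k → ∀ K : Finset V,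
      (∀ x ∈ K, ∀ y ∈ K, x ≠ y → (lcChain G parts (i + 1)).2.Adj x y) →
      ∃ T ⊆ K, T.card ≤ i ∧ Near G {x | x ∈ K ∧ x ∉ T} := by
  intro i
  induction i with
  | zero =>
    intro hi K hK
    have hsnc := (hp.2.2.2.2 ⟨0, hi⟩).2.1.snc
    have h1 : (lcChain G parts (0 + 1)).1 =
        removeVerts G {v | ∃ j : Fin k, 0 + 1 ≤ (j : ℕ) ∧ v ∈ parts j} := by
      simp only [lcChain]
      refine sup_eq_right.2 ?_
      intro x y h
      exact ⟨h.1, fun ⟨j, _, hj⟩ => h.2.1 ⟨j, hj⟩, fun ⟨j, _, hj⟩ => h.2.2 ⟨j, hj⟩⟩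
    have h2 : (lcChain G parts (0 + 1)).2 =
        chordalizeList (lcChain G parts (0 + 1)).1 (parts ⟨0, hi⟩) := by
      simp only [lcChain, dif_pos hi]
    rw [h2] at hK
    have hnear := near_of_clique hsnc (K := {x | x ∈ K}) hK
    change Near (lcChain G parts (0 + 1)).1 _ at hnear
    rw [h1] at hnear
    refine ⟨∅, by simp, by simp, ?_⟩
    have e : {x | x ∈ K ∧ x ∉ (∅ : Finset V)} = {x | x ∈ K} := by ext; simp
    rw [e]
    rcases hnear with h | ⟨u, hu, h, h'⟩
    · exact Or.inl fun x hx y hy hne => (h x hx y hy hne).1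
    · refine Or.inr ⟨u, hu, fun x hx y hy hxu hyu hne => (h x hx y hy hxu hyu hne).1, ?_⟩
      intro y hy hyu
      rcases h' y hy hyu with h'' | ⟨S, hS, hs⟩
      · exact Or.inl h''.1
      · exact Or.inr ⟨S, hS.of_removeVerts, hs⟩
  | succ i ih =>
    intro hi K hK
    have hsnc := (hp.2.2.2.2 ⟨i + 1, hi⟩).2.1.snc
    have h2 : (lcChain G parts (i + 1 + 1)).2 =
        chordalizeList (lcChain G parts (i + 1 + 1)).1 (parts ⟨i + 1, hi⟩) := by
      rw [lcChain]
      simp only [dif_pos hi]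
    rw [h2] at hK
    have hnear := near_of_clique hsnc (K := {x | x ∈ K}) hK
    change Near (lcChain G parts (i + 1 + 1)).1 _ at hnear
    have h1 : ∀ x y, (lcChain G parts (i + 1 + 1)).1.Adj x y →
        (lcChain G parts (i + 1)).2.Adj x y ∨
        (removeVerts G {v | ∃ j : Fin k, i + 1 + 1 ≤ (j : ℕ) ∧ v ∈ parts j}).Adj x y := by
      intro x y h
      rw [lcChain] at h
      exact h
    -- a set of at most one vertex to be removed at this level
    obtain ⟨T₁, hT₁K, hT₁, hcl⟩ : ∃ T₁ ⊆ K, T₁.card ≤ 1 ∧ ∀ x ∈ K, ∀ y ∈ K, x ∉ T₁ → y ∉ T₁ →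
        x ≠ y → (lcChain G parts (i + 1 + 1)).1.Adj x y := by
      rcases hnear with h | ⟨u, hu, h, -⟩
      · exact ⟨∅, by simp, by simp, fun x hx y hy _ _ hne => h x hx y hy hne⟩
      · refine ⟨{u}, by simpa using hu, by simp, ?_⟩
        intro x hx y hy hxu hyu hne
        exact h x hx y hy (by simpa using hxu) (by simpa using hyu) hne
    let P : Finset V := (parts ⟨i + 1, hi⟩).toFinset
    have hP : ∀ x, x ∈ P ↔ x ∈ parts ⟨i + 1, hi⟩ := fun x => List.mem_toFinset
    -- edges at the current part come from `G`
    have hPG : ∀ x ∈ K, ∀ y ∈ K, x ∉ T₁ → y ∉ T₁ → x ≠ y → x ∈ P → G.Adj x y := by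
      intro x hx y hy hxT hyT hne hxP
      rcases h1 x y (hcl x hx y hy hxT hyT hne) with h | h
      · exact absurd h (lcChain_isolated G parts (i + 1) ⟨i + 1, hi⟩ le_rfl x ((hP x).1 hxP) y)
      · exact h.1
    obtain ⟨T, hTK, hT, hN⟩ := ih (by omega) ((K \ T₁) \ P) (by
      intro x hx y hy hne
      simp only [Finset.mem_sdiff] at hx hy
      rcases h1 x y (hcl x hx.1.1 y hy.1.1 hx.1.2 hy.1.2 hne) with h | h
      · exact h
      · refine le_lcChain G parts (i + 1) ⟨h.1, ?_, ?_⟩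
        · rintro ⟨j, hj, hxj⟩
          rcases Nat.lt_or_ge (i + 1) j with h' | h'
          · exact h.2.1 ⟨j, h', hxj⟩
          · obtain rfl : j = ⟨i + 1, hi⟩ := Fin.ext (by simp; omega)
            exact hx.2 ((hP x).2 hxj)
        · rintro ⟨j, hj, hxj⟩
          rcases Nat.lt_or_ge (i + 1) j with h' | h'
          · exact h.2.2 ⟨j, h', hxj⟩
          · obtain rfl : j = ⟨i + 1, hi⟩ := Fin.ext (by simp; omega)
            exact hy.2 ((hP y).2 hxj))
    refine ⟨T₁ ∪ T, ?_, ?_, ?_⟩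
    · refine Finset.union_subset hT₁K (hTK.trans ?_)
      exact Finset.sdiff_subset.trans Finset.sdiff_subset
    · have := Finset.card_union_le T₁ T
      omega
    · have lift : ∀ x, x ∈ {x | x ∈ K ∧ x ∉ T₁ ∪ T} → x ∉ P →
          x ∈ {x | x ∈ (K \ T₁) \ P ∧ x ∉ T} := by
        rintro x ⟨hxK, hxT⟩ hxP
        simp only [Finset.mem_union, not_or] at hxT
        exact ⟨by simp [hxK, hxT.1, hxP], hxT.2⟩
      have hPG' : ∀ x ∈ {x | x ∈ K ∧ x ∉ T₁ ∪ T}, ∀ y ∈ {x | x ∈ K ∧ x ∉ T₁ ∪ T}, x ≠ y →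
          (x ∈ P ∨ y ∈ P) → G.Adj x y := by
        rintro x ⟨hxK, hxT⟩ y ⟨hyK, hyT⟩ hne hP'
        simp only [Finset.mem_union, not_or] at hxT hyT
        rcases hP' with h | h
        · exact hPG x hxK y hyK hxT.1 hyT.1 hne h
        · exact (hPG y hyK x hxK hyT.1 hxT.1 hne.symm h).symm
      rcases hN with h | ⟨u, ⟨huK, huT⟩, h, h'⟩
      · left
        intro x hx y hy hne
        by_cases hc : x ∈ P ∨ y ∈ P
        · exact hPG' x hx y hy hne hc
        · rw [not_or] at hc
          exact h x (lift x hx hc.1) y (lift y hy hc.2) hne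
      · right
        simp only [Finset.mem_sdiff] at huK
        have hu : u ∈ {x | x ∈ K ∧ x ∉ T₁ ∪ T} := by
          refine ⟨huK.1.1, ?_⟩
          simp [huK.1.2, huT]
        refine ⟨u, hu, ?_, ?_⟩
        · intro x hx y hy hxu hyu hne
          by_cases hc : x ∈ P ∨ y ∈ P
          · exact hPG' x hx y hy hne hc
          · rw [not_or] at hc
            exact h x (lift x hx hc.1) y (lift y hy hc.2) hxu hyu hne
        · intro y hy hyu
          by_cases hc : y ∈ P
          · exact Or.inl (hPG' u hu y hy hyu.symm (Or.inr hc))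
          · exact h' y (lift y hy hc) hyu

/-! ### Minors -/

theorem conn_of_star {G : SimpleGraph V} {U : Set V} {u : V}
    (h : ∀ x ∈ U, ∃ W ⊆ U, Conn G W ∧ u ∈ W ∧ x ∈ W) : Conn G U := by
  intro x hx y hy
  obtain ⟨W, hW, hc, hu, hx⟩ := h x hx
  obtain ⟨W', hW', hc', hu', hy⟩ := h y hy
  exact (stepIn_mono hW (hc x hx u hu)).trans (stepIn_mono hW' (hc' u hu' y hy))

theorem Near.hasMinor {G : SimpleGraph V} {K : Finset V} (h : Near G {x | x ∈ K}) :
    HasMinor G (⊤ : SimpleGraph (Fin K.card)) := by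
  classical
  rcases K.eq_empty_or_nonempty with rfl | ⟨u₀, hu₀⟩
  · refine ⟨fun _ => ∅, ?_, ?_, ?_, ?_⟩
    · intro i; exact i.elim0
    · intro i; exact i.elim0
    · intro i; exact i.elim0
    · intro i; exact i.elim0
  obtain ⟨u, hu, hcl, hfar⟩ : ∃ u ∈ K, (∀ x ∈ K, ∀ y ∈ K, x ≠ u → y ≠ u → x ≠ y → G.Adj x y) ∧
      ∀ y ∈ K, y ≠ u → G.Adj u y ∨ ∃ S, HoleSet G S ∧ u ∈ S ∧ y ∈ S := by
    rcases h with h | h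
    · exact ⟨u₀, hu₀, fun x hx y hy _ _ hne => h x hx y hy hne,
        fun y hy hne => Or.inl (h u₀ hu₀ y hy hne.symm)⟩
    · exact h
  have hone : ∀ y, ∃ W : Set V, (y ∈ K → y ≠ u → ∃ a ∈ W, G.Adj a y) ∧ Conn G W ∧ u ∈ W ∧
      ∀ x ∈ W, x ∈ K → x = u := by
    intro y
    by_cases hy : y ∈ K ∧ y ≠ u ∧ ¬ G.Adj u y
    · obtain ⟨hyK, hyu, hn⟩ := hy
      obtain ⟨S, hS, huS, hyS⟩ := (hfar y hyK hyu).resolve_left hn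
      obtain ⟨A, B, hA, hB, hAB⟩ := hS.split huS hyS hyu.symm hn
      have side : ∀ A, Side G S u y A → (∀ x ∈ A, x ∉ K) →
          ∃ W : Set V, (y ∈ K → y ≠ u → ∃ a ∈ W, G.Adj a y) ∧ Conn G W ∧ u ∈ W ∧
            ∀ x ∈ W, x ∈ K → x = u := by
        intro A hA hAK
        obtain ⟨r, hrA, hr, -⟩ := hA.endu
        obtain ⟨a, haA, ha, -⟩ := hA.enda
        refine ⟨{u} ∪ A, fun _ _ => ⟨a, Or.inr haA, ha.symm⟩,
          (conn_singleton G u).union hA.conn ⟨u, rfl, r, hrA, Or.inr hr⟩, Or.inl rfl, ?_⟩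
        rintro x (hx | hx) hxK
        · exact hx
        · exact absurd hxK (hAK x hx)
      by_cases hAK : ∀ x ∈ A, x ∉ K
      · exact side A hA hAK
      · refine side B hB ?_
        push Not at hAK
        obtain ⟨x, hxA, hxK⟩ := hAK
        intro z hzB hzK
        refine hAB ⟨x, hxA, z, hzB, ?_⟩
        by_cases hxz : x = z
        · exact Or.inl hxz
        · exact Or.inr (hcl x hxK z hzK (fun e => hA.hu (e ▸ hxA)) (fun e => hB.hu (e ▸ hzB)) hxz)
    · refine ⟨{u}, ?_, conn_singleton G u, rfl, fun x hx _ => hx⟩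
      intro hyK hyu
      refine ⟨u, rfl, ?_⟩
      by_contra hn
      exact hy ⟨hyK, hyu, hn⟩
  choose W hW1 hW2 hW3 hW4 using hone
  let U : Set V := ⋃ y, W y
  have hUc : Conn G U := by
    refine conn_of_star (u := u) ?_
    intro x hx
    obtain ⟨y, hy⟩ := Set.mem_iUnion.1 hx
    exact ⟨W y, Set.subset_iUnion W y, hW2 y, hW3 y, hy⟩
  have huU : u ∈ U := Set.mem_iUnion.2 ⟨u, hW3 u⟩
  have hUK : ∀ x ∈ U, x ∈ K → x = u := by
    intro x hx hxK
    obtain ⟨y, hy⟩ := Set.mem_iUnion.1 hx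
    exact hW4 y x hy hxK
  have hUadj : ∀ y ∈ K, y ≠ u → ∃ a ∈ U, G.Adj a y := by
    intro y hy hyu
    obtain ⟨a, ha, hay⟩ := hW1 y hy hyu
    exact ⟨a, Set.mem_iUnion.2 ⟨y, ha⟩, hay⟩
  let e := K.equivFin.symm
  have hinj : ∀ i j, i ≠ j → (e i : V) ≠ e j := by
    intro i j hij h'
    exact hij (e.injective (Subtype.ext h'))
  refine ⟨fun i => if (e i : V) = u then U else {(e i : V)}, ?_, ?_, ?_, ?_⟩
  · intro i
    dsimp only
    split_ifs
    · exact ⟨u, huU⟩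
    · exact ⟨_, rfl⟩
  · intro i
    have hc : Conn G (if (e i : V) = u then U else {(e i : V)}) := by
      split_ifs
      · exact hUc
      · exact conn_singleton G _
    have hne : (if (e i : V) = u then U else {(e i : V)}).Nonempty := by
      split_ifs
      · exact ⟨u, huU⟩
      · exact ⟨_, rfl⟩
    exact hc.connected hne
  · intro i j hij
    have hne := hinj i j hij
    dsimp only
    rw [Set.disjoint_left]
    intro x hxi hxj
    split_ifs at hxi hxj with h1 h2 h2
    · exact hne (h1.trans h2.symm)
    · obtain rfl : x = e j := hxj
      exact h2 (hUK _ hxi (e j).2)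
    · obtain rfl : x = e i := hxi
      exact h1 (hUK _ hxj (e i).2)
    · exact hne ((Set.mem_singleton_iff.1 hxi).symm.trans hxj)
  · intro i j hij
    have hne := hinj i j hij.ne
    dsimp only
    split_ifs with h1 h2 h2
    · exact absurd (h1.trans h2.symm) hne
    · obtain ⟨a, ha, hadj⟩ := hUadj (e j) (e j).2 h2
      exact ⟨a, ha, _, rfl, hadj⟩
    · obtain ⟨a, ha, hadj⟩ := hUadj (e i) (e i).2 h1
      exact ⟨_, rfl, a, ha, hadj.symm⟩
    · exact ⟨_, rfl, _, rfl, hcl _ (e i).2 _ (e j).2 h1 h2 hne⟩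

theorem HasMinor.mono_top {G : SimpleGraph V} {m n : ℕ} (hnm : n ≤ m)
    (h : HasMinor G (⊤ : SimpleGraph (Fin m))) : HasMinor G (⊤ : SimpleGraph (Fin n)) := by
  obtain ⟨B, h1, h2, h3, h4⟩ := h
  refine ⟨fun i => B (Fin.castLE hnm i), fun i => h1 _, fun i => h2 _, ?_, ?_⟩
  · intro i j hij
    exact h3 fun e => hij (Fin.castLE_injective hnm e)
  · intro i j hij
    exact h4 _ _ fun e => hij.ne (Fin.castLE_injective hnm e)

/-! ### The main bounds -/

theorem pos_of_partition {G : SimpleGraph V} {C : Set V} {k : ℕ} {parts : Fin k → List V}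
    (hcov : IsHoleCover G C) (hp : IsLCPartition G C parts) : 0 < k := by
  obtain ⟨v, hv⟩ := hcov.1
  rw [← hp.2.2.2.1] at hv
  obtain ⟨i, -⟩ := hv
  exact i.pos

theorem exists_clique_of_lcChain [DecidableEq V] {G : SimpleGraph V} {C : Set V} {k : ℕ}
    {parts : Fin k → List V} (hcov : IsHoleCover G C) (hp : IsLCPartition G C parts)
    {K : Finset V} (hK : (lcChain G parts k).2.IsClique K) :
    ∃ K' ⊆ K, G.IsClique K' ∧ K.card ≤ K'.card + k := by
  have hk := pos_of_partition hcov hp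
  obtain ⟨i, rfl⟩ : ∃ i, k = i + 1 := ⟨k - 1, by omega⟩
  obtain ⟨T, hTK, hT, hN⟩ := lcChain_clique G parts hp i (by omega) K
    (fun x hx y hy hne => hK hx hy hne)
  rcases hN with h | ⟨u, hu, h, -⟩
  · refine ⟨K \ T, Finset.sdiff_subset, ?_, ?_⟩
    · intro x hx y hy hne
      simp only [Finset.coe_sdiff, Set.mem_sdiff, Finset.mem_coe] at hx hy
      exact h x hx y hy hne
    · have := Finset.le_card_sdiff T K
      omega
  · refine ⟨(K \ T).erase u, (Finset.erase_subset _ _).trans Finset.sdiff_subset, ?_, ?_⟩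
    · intro x hx y hy hne
      simp only [Finset.coe_erase, Finset.coe_sdiff, Set.mem_sdiff, Finset.mem_coe,
        Set.mem_singleton_iff] at hx hy
      exact h x hx.1 y hy.1 hx.2 hy.2 hne
    · have h1 := Finset.le_card_sdiff T K
      have h2 := Finset.pred_card_le_card_erase (s := K \ T) (a := u)
      omega

theorem main_bounds [Fintype V] [DecidableEq V] (G : SimpleGraph V) (C : Set V) {k : ℕ}
    (parts : Fin k → List V) (hcov : IsHoleCover G C) (hp : IsLCPartition G C parts) :
    (∀ S : Set V, (((lcChain G parts k).2).induce S).cliqueNum ≤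
        (G.induce S).cliqueNum + k) ∧
    ((lcChain G parts k).2).cliqueNum ≤ G.cliqueNum + k ∧
    (¬ IsChordal G → ∀ n : ℕ, ¬ HasMinor G (⊤ : SimpleGraph (Fin n)) →
      ((lcChain G parts k).2).cliqueNum ≤ n - 2 + k) := by
  classical
  have hk := pos_of_partition hcov hp
  refine ⟨?_, ?_, ?_⟩
  · intro S
    obtain ⟨s, hs⟩ := ((lcChain G parts k).2.induce S).exists_isNClique_cliqueNum
    have hK : (lcChain G parts k).2.IsClique
        (s.map (Function.Embedding.subtype (· ∈ S)) : Finset V) := by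
      intro x hx y hy hne
      simp only [Finset.coe_map, Set.mem_image, Finset.mem_coe] at hx hy
      obtain ⟨x', hx', rfl⟩ := hx
      obtain ⟨y', hy', rfl⟩ := hy
      exact hs.isClique hx' hy' (fun e => hne (by rw [e]))
    obtain ⟨K', hK'K, hK', hcard⟩ := exists_clique_of_lcChain hcov hp hK
    rw [Finset.card_map, hs.card_eq] at hcard
    have hsub : ∀ x ∈ K', x ∈ S := by
      intro x hx
      obtain ⟨x', -, rfl⟩ := Finset.mem_map.1 (hK'K hx)
      exact x'.2
    have hc : (G.induce S).IsClique (K'.subtype (· ∈ S) : Finset S) := by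
      intro x hx y hy hne
      simp only [Finset.mem_coe, Finset.mem_subtype] at hx hy
      exact hK' hx hy (fun e => hne (Subtype.ext e))
    have hle := hc.card_le_cliqueNum
    rw [Finset.card_subtype, Finset.filter_true_of_mem hsub] at hle
    omega
  · obtain ⟨K, hK⟩ := (lcChain G parts k).2.exists_isNClique_cliqueNum
    obtain ⟨K', -, hK', hcard⟩ := exists_clique_of_lcChain hcov hp hK.isClique
    have hle := hK'.card_le_cliqueNum
    rw [hK.card_eq] at hcard
    omega
  · intro _ n hn
    obtain ⟨K, hK⟩ := (lcChain G parts k).2.exists_isNClique_cliqueNum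
    obtain ⟨i, rfl⟩ : ∃ i, k = i + 1 := ⟨k - 1, by omega⟩
    obtain ⟨T, hTK, hT, hN⟩ := lcChain_clique G parts hp i (by omega) K
      (fun x hx y hy hne => hK.isClique hx hy hne)
    have hN' : Near G {x | x ∈ K \ T} := by simpa only [Finset.mem_sdiff] using hN
    have h1 : (K \ T).card < n := by
      by_contra hlt
      exact hn (HasMinor.mono_top (by omega) hN'.hasMinor)
    have h2 : 1 < n := by
      by_contra hlt
      obtain ⟨v, -⟩ := hcov.1
      have hv : Near G {x | x ∈ ({v} : Finset V)} := by
        left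
        intro x hx y hy hne
        simp only [Finset.mem_singleton, Set.mem_ofPred_eq] at hx hy
        exact absurd (hx.trans hy.symm) hne
      exact hn (HasMinor.mono_top (by simpa using hlt) hv.hasMinor)
    have h3 := Finset.le_card_sdiff T K
    have h4 := hK.card_eq
    omega

/-- for a local chordalization partition realizing `i(G)`, the last
chain graph `G*` satisfies `ω(H*) ≤ ω(H) + i(G)` for every induced subgraph `H` of
`G` (in particular `ω(G*) ≤ ω(G) + i(G)`), and if `G` is non-chordal and has no
`K_n` minor, then `ω(G*) ≤ n - 2 + i(G)`. -/
theorem stmt16 {V : Type*} [Fintype V] [DecidableEq V] (G : SimpleGraph V) (C : Set V)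
    (parts : Fin (ncIndex G) → List V)
    (hcov : IsHoleCover G C) (hpart : IsLCPartition G C parts) :
    (∀ S : Set V,
      (((lcChain G parts (ncIndex G)).2).induce S).cliqueNum ≤
        (G.induce S).cliqueNum + ncIndex G) ∧
    ((lcChain G parts (ncIndex G)).2).cliqueNum ≤ G.cliqueNum + ncIndex G ∧
    (¬ IsChordal G → ∀ n : ℕ, ¬ HasMinor G (⊤ : SimpleGraph (Fin n)) →
      ((lcChain G parts (ncIndex G)).2).cliqueNum ≤ n - 2 + ncIndex G) := by
  exact main_bounds G C parts hcov hpart
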